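/- arXiv:1911.01743 — 3 statements merged into one kernel-verified Lean document; each statement's English description precedes it below -/
import Mathlib

section
/- For every positive integer n, the unitary Möbius inversion formula Φ*_n(x) = ∏_{d ∣∣ n} (x^d − 1)^{μ*(n/d)} holds; equivalently, as an identity of polynomials, Φ*_n(x) · ∏_{d ∣∣ n, μ*(n/d) = −1} (x^d − 1) = ∏_{d ∣∣ n, μ*(n/d) = 1} (x^d − 1). -/
open Polynomial Finset

/-- The finset of unitary divisors of `n`: divisors `d` of `n` with `gcd (d, n / d) = 1`. -/
def unitaryDivisors (n : ℕ) : Finset ℕ :=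
  n.divisors.filter fun d => Nat.Coprime d (n / d)

/-- `d ∣∣ n`: `d` is a unitary divisor of `n`. -/
def IsUnitaryDivisor (d n : ℕ) : Prop := d ∈ unitaryDivisors n

/-- `(j, n)_*`: the greatest `d` such that `d ∣ j` and `d` is a unitary divisor of `n`. -/
def unitaryGcd (j n : ℕ) : ℕ :=
  ((unitaryDivisors n).filter fun d => d ∣ j).sup id

/-- `κ(n)`: the squarefree kernel (radical) of `n`. -/
def kernel (n : ℕ) : ℕ := ∏ p ∈ n.primeFactors, p

/-- `φ*(n)`: the unitary Euler totient function. -/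
def unitaryTotient (n : ℕ) : ℕ :=
  ((Finset.Icc 1 n).filter fun j => unitaryGcd j n = 1).card

/-- `μ*(n) = (-1)^{ω(n)}`: the unitary Moebius function. -/
def unitaryMoebius (n : ℕ) : ℤ := (-1) ^ n.primeFactors.card

/-- `Φ*_n`: the unitary cyclotomic polynomial (over `ℂ`). -/
noncomputable def unitaryCyclotomic (n : ℕ) : Polynomial ℂ :=
  ∏ j ∈ (Finset.Icc 1 n).filter fun j => unitaryGcd j n = 1,
    (X - C (Complex.exp (2 * (Real.pi : ℂ) * Complex.I * (j : ℂ) / (n : ℂ))))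

/-- `c*_n(k)`: the unitary Ramanujan sum. -/
noncomputable def unitaryRamanujan (n k : ℕ) : ℂ :=
  ∑ j ∈ (Finset.Icc 1 n).filter fun j => unitaryGcd j n = 1,
    Complex.exp (2 * (Real.pi : ℂ) * Complex.I * (j : ℂ) * (k : ℂ) / (n : ℂ))

/-- `c_n(k)`: the classical Ramanujan sum. -/
noncomputable def ramanujanSum (n k : ℕ) : ℂ :=
  ∑ j ∈ (Finset.Icc 1 n).filter fun j => Nat.Coprime j n,
    Complex.exp (2 * (Real.pi : ℂ) * Complex.I * (j : ℂ) * (k : ℂ) / (n : ℂ))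

/-- The unitary convolution `(f × g)(n) = ∑_{d ∣∣ n} f(d) g(n/d)`. -/
noncomputable def unitaryConv (f g : ℕ → ℂ) (n : ℕ) : ℂ :=
  ∑ d ∈ unitaryDivisors n, f d * g (n / d)

/-- `Λ*(n)`: the unitary von Mangoldt function, `a log p` for `n = p^a`, else `0`. -/
noncomputable def unitaryVonMangoldt (n : ℕ) : ℝ :=
  if IsPrimePow n then (n.factorization n.minFac : ℝ) * Real.log n.minFac else 0
lemma mem_unitaryDivisors {d n : ℕ} :
    d ∈ unitaryDivisors n ↔ (d ∣ n ∧ n ≠ 0) ∧ d.Coprime (n / d) := by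
  simp [unitaryDivisors]

lemma div_mem_unitaryDivisors {d n : ℕ} (h : d ∈ unitaryDivisors n) :
    n / d ∈ unitaryDivisors n := by
  rw [mem_unitaryDivisors] at h ⊢
  obtain ⟨⟨hd, hn⟩, hc⟩ := h
  refine ⟨⟨Nat.div_dvd_of_dvd hd, hn⟩, ?_⟩
  rw [Nat.div_div_self hd hn]
  exact hc.symm

lemma prod_primeFactors_pow_factorization_of_mem_unitaryDivisors {e n : ℕ}
    (h : e ∈ unitaryDivisors n) :
    ∏ p ∈ e.primeFactors, p ^ n.factorization p = e := by
  rw [mem_unitaryDivisors] at h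
  obtain ⟨⟨hd, hn⟩, hc⟩ := h
  have he : e ≠ 0 := ne_zero_of_dvd_ne_zero hn hd
  conv_rhs => rw [← Nat.prod_factorization_pow_eq_self he]
  refine Finset.prod_congr rfl fun p hp => ?_
  have := Nat.factorization_eq_of_coprime_left hc (Nat.mem_primeFactors_iff_mem_primeFactorsList.1 hp)
  rw [Nat.mul_div_cancel' hd] at this
  rw [this]

lemma primeFactors_prod_pow_factorization {n : ℕ} {T : Finset ℕ} (hT : T ⊆ n.primeFactors) :
    (∏ p ∈ T, p ^ n.factorization p).primeFactors = T := by
  ext q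
  have hpos : ∀ p ∈ T, p ^ n.factorization p ≠ 0 := fun p hp =>
    pow_ne_zero _ (Nat.prime_of_mem_primeFactors (hT hp)).ne_zero
  rw [Nat.mem_primeFactors_of_ne_zero (Finset.prod_ne_zero_iff.2 hpos)]
  constructor
  · rintro ⟨hq, hdvd⟩
    obtain ⟨p, hp, hqp⟩ := (hq.prime.dvd_finsetProd_iff _).1 hdvd
    rwa [(Nat.prime_dvd_prime_iff_eq hq (Nat.prime_of_mem_primeFactors (hT hp))).1
      (hq.dvd_of_dvd_pow hqp)]
  · intro hq
    have hqn := hT hq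
    have hqp := Nat.prime_of_mem_primeFactors hqn
    exact ⟨hqp, (dvd_pow_self q (Finsupp.mem_support_iff.1 hqn)).trans (Finset.dvd_prod_of_mem _ hq)⟩

lemma prod_pow_factorization_mem_unitaryDivisors {n : ℕ} (hn : n ≠ 0) {T : Finset ℕ}
    (hT : T ⊆ n.primeFactors) :
    ∏ p ∈ T, p ^ n.factorization p ∈ unitaryDivisors n := by
  have hmul : (∏ p ∈ T, p ^ n.factorization p) *
      ∏ p ∈ n.primeFactors \ T, p ^ n.factorization p = n := by
    rw [mul_comm, Finset.prod_sdiff hT]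
    exact Nat.prod_factorization_pow_eq_self hn
  have hpos : 0 < ∏ p ∈ T, p ^ n.factorization p :=
    Nat.pos_of_ne_zero fun h => hn (by rw [← hmul, h, zero_mul])
  rw [mem_unitaryDivisors]
  refine ⟨⟨Dvd.intro _ hmul, hn⟩, ?_⟩
  rw [Nat.div_eq_of_eq_mul_right hpos hmul.symm]
  refine Nat.Coprime.prod_left fun p hp => Nat.Coprime.prod_right fun q hq => ?_
  rw [Finset.mem_sdiff] at hq
  refine Nat.Coprime.pow _ _ ((Nat.coprime_primes (Nat.prime_of_mem_primeFactors (hT hp))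
    (Nat.prime_of_mem_primeFactors hq.1)).2 ?_)
  rintro rfl
  exact hq.2 hp

lemma pow_factorization_dvd_of_mem_unitaryDivisors {e n p : ℕ} (h : e ∈ unitaryDivisors n)
    (hp : p ∈ e.primeFactors) : p ^ n.factorization p ∣ e := by
  conv_rhs => rw [← prod_primeFactors_pow_factorization_of_mem_unitaryDivisors h]
  exact Finset.dvd_prod_of_mem (fun p => p ^ n.factorization p) hp

lemma unitaryGcd_eq_one_iff {n : ℕ} (hn : n ≠ 0) (j : ℕ) :
    unitaryGcd j n = 1 ↔ {p ∈ n.primeFactors | p ^ n.factorization p ∣ j} = ∅ := by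
  rw [Finset.filter_eq_empty_iff]
  constructor
  · intro h p hp hpj
    have hmem : p ^ n.factorization p ∈ unitaryDivisors n := by
      simpa using prod_pow_factorization_mem_unitaryDivisors hn (Finset.singleton_subset_iff.2 hp)
    have hle : p ^ n.factorization p ≤ 1 := by
      rw [← h]
      exact Finset.le_sup (f := id) (Finset.mem_filter.2 ⟨hmem, hpj⟩)
    exact absurd hle (not_le.2 (Nat.one_lt_pow (Finsupp.mem_support_iff.1 hp)
      (Nat.prime_of_mem_primeFactors hp).one_lt))
  · intro h
    have hS : (unitaryDivisors n).filter (fun d => d ∣ j) = {1} := by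
      ext e
      rw [Finset.mem_filter, Finset.mem_singleton]
      constructor
      · rintro ⟨he, hej⟩
        have hempty : e.primeFactors = ∅ := by
          refine Finset.eq_empty_of_forall_notMem fun p hp => ?_
          exact h (Nat.primeFactors_mono (mem_unitaryDivisors.1 he).1.1 hn hp)
            ((pow_factorization_dvd_of_mem_unitaryDivisors he hp).trans hej)
        rw [← prod_primeFactors_pow_factorization_of_mem_unitaryDivisors he, hempty,
          Finset.prod_empty]
      · rintro rfl
        simp [mem_unitaryDivisors, hn]
    simp [unitaryGcd, hS]

lemma sum_unitaryMoebius_dvd {n : ℕ} (hn : n ≠ 0) (j : ℕ) :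
    ∑ e ∈ unitaryDivisors n with e ∣ j, unitaryMoebius e =
      if unitaryGcd j n = 1 then 1 else 0 := by
  simp only [unitaryGcd_eq_one_iff hn, ← Finset.sum_powerset_neg_one_pow_card]
  refine Finset.sum_bij' (fun e _ => e.primeFactors) (fun T _ => ∏ p ∈ T, p ^ n.factorization p)
    ?_ ?_ ?_ ?_ ?_
  · intro e he
    rw [Finset.mem_filter] at he
    rw [Finset.mem_powerset]
    intro p hp
    exact Finset.mem_filter.2 ⟨Nat.primeFactors_mono (mem_unitaryDivisors.1 he.1).1.1 hn hp,
      (pow_factorization_dvd_of_mem_unitaryDivisors he.1 hp).trans he.2⟩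
  · intro T hT
    rw [Finset.mem_powerset] at hT
    have hTn := hT.trans (Finset.filter_subset _ _)
    refine Finset.mem_filter.2 ⟨prod_pow_factorization_mem_unitaryDivisors hn hTn, ?_⟩
    refine Finset.prod_dvd_of_isRelPrime ?_ fun p hp => (Finset.mem_filter.1 (hT hp)).2
    intro p hp q hq hpq
    exact Nat.coprime_iff_isRelPrime.1 (Nat.Coprime.pow _ _
      ((Nat.coprime_primes (Nat.prime_of_mem_primeFactors (hTn hp))
        (Nat.prime_of_mem_primeFactors (hTn hq))).2 hpq))
  · intro e he
    exact prod_primeFactors_pow_factorization_of_mem_unitaryDivisors (Finset.mem_filter.1 he).1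
  · intro T hT
    exact primeFactors_prod_pow_factorization
      ((Finset.mem_powerset.1 hT).trans (Finset.filter_subset _ _))
  · intro e _
    rfl

lemma unitaryMoebius_eq_one_or (n : ℕ) : unitaryMoebius n = 1 ∨ unitaryMoebius n = -1 :=
  neg_one_pow_eq_or ℤ _

lemma card_unitaryMoebius_eq_neg_one_add {n : ℕ} (hn : n ≠ 0) (j : ℕ) :
    (if unitaryGcd j n = 1 then 1 else 0) +
        #{d ∈ unitaryDivisors n | unitaryMoebius (n / d) = -1 ∧ n / d ∣ j} =
      #{d ∈ unitaryDivisors n | unitaryMoebius (n / d) = 1 ∧ n / d ∣ j} := by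
  have hsum : ∑ d ∈ unitaryDivisors n with n / d ∣ j, unitaryMoebius (n / d) =
      if unitaryGcd j n = 1 then 1 else 0 := by
    rw [← sum_unitaryMoebius_dvd hn j]
    have hinv : ∀ d ∈ unitaryDivisors n, n / (n / d) = d := fun d hd =>
      Nat.div_div_self (mem_unitaryDivisors.1 hd).1.1 hn
    refine Finset.sum_bij' (fun d _ => n / d) (fun e _ => n / e) ?_ ?_ ?_ ?_ ?_
    · intro d hd
      rw [Finset.mem_filter] at hd ⊢
      exact ⟨div_mem_unitaryDivisors hd.1, hd.2⟩
    · intro e he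
      rw [Finset.mem_filter] at he ⊢
      rw [hinv e he.1]
      exact ⟨div_mem_unitaryDivisors he.1, he.2⟩
    · exact fun d hd => hinv d (Finset.mem_filter.1 hd).1
    · exact fun e he => hinv e (Finset.mem_filter.1 he).1
    · exact fun _ _ => rfl
  rw [← Nat.cast_inj (R := ℤ)]
  push_cast
  rw [← hsum, Finset.natCast_card_filter, Finset.natCast_card_filter, Finset.sum_filter,
    ← Finset.sum_add_distrib]
  refine Finset.sum_congr rfl fun d _ => ?_
  rcases unitaryMoebius_eq_one_or (n / d) with h | h <;> by_cases hj : n / d ∣ j <;> simp [h, hj]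

lemma X_pow_sub_one_eq_prod_filter_dvd {ζ : ℂ} {n d : ℕ} (hζ : IsPrimitiveRoot ζ n) (hn : 0 < n)
    (hd : d ∣ n) :
    (X : ℂ[X]) ^ d - 1 = ∏ j ∈ Icc 1 n with n / d ∣ j, (X - C (ζ ^ j)) := by
  obtain ⟨m, rfl⟩ := hd
  have hdpos : 0 < d := Nat.pos_of_mul_pos_right hn
  have hpow : ∀ j, (ζ ^ j) ^ d = 1 ↔ m ∣ j := fun j => by
    rw [← pow_mul, hζ.pow_eq_one_iff_dvd, mul_comm j d, Nat.mul_dvd_mul_iff_left hdpos]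
  rw [Nat.mul_div_cancel_left m hdpos,
    X_pow_sub_one_eq_prod hdpos (Complex.isPrimitiveRoot_exp d hdpos.ne')]
  refine (Finset.prod_bij (fun j _ => ζ ^ j) ?_ ?_ ?_ ?_).symm
  · intro j hj
    rw [mem_nthRootsFinset hdpos, hpow]
    exact (Finset.mem_filter.1 hj).2
  · intro j hj k hk hjk
    have hj' := Finset.mem_Icc.1 (Finset.mem_filter.1 hj).1
    have hk' := Finset.mem_Icc.1 (Finset.mem_filter.1 hk).1
    have hζ0 : ζ ≠ 0 := hζ.ne_zero hn.ne'
    have hsub : j - 1 = k - 1 := by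
      refine hζ.pow_inj (by omega) (by omega) (mul_right_cancel₀ hζ0 ?_)
      rwa [← pow_succ, ← pow_succ, Nat.sub_add_cancel hj'.1, Nat.sub_add_cancel hk'.1]
    omega
  · intro w hw
    rw [mem_nthRootsFinset hdpos] at hw
    have : NeZero (d * m) := ⟨hn.ne'⟩
    obtain ⟨i, hi, rfl⟩ := hζ.eq_pow_of_pow_eq_one (ξ := w) (by rw [pow_mul, hw, one_pow])
    rcases Nat.eq_zero_or_pos i with rfl | hipos
    · exact ⟨d * m, Finset.mem_filter.2 ⟨Finset.mem_Icc.2 ⟨hn, le_rfl⟩, Dvd.intro_left _ rfl⟩,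
        by rw [hζ.pow_eq_one, pow_zero]⟩
    · exact ⟨i, Finset.mem_filter.2 ⟨Finset.mem_Icc.2 ⟨hipos, hi.le⟩, (hpow i).1 hw⟩, rfl⟩
  · exact fun _ _ => rfl

lemma prod_X_pow_sub_one_unitaryDivisors {ζ : ℂ} {n : ℕ} (hζ : IsPrimitiveRoot ζ n) (hn : 0 < n)
    (s : ℤ) :
    ∏ d ∈ unitaryDivisors n with unitaryMoebius (n / d) = s, ((X : ℂ[X]) ^ d - 1) =
      ∏ j ∈ Icc 1 n, (X - C (ζ ^ j)) ^
        #{d ∈ unitaryDivisors n | unitaryMoebius (n / d) = s ∧ n / d ∣ j} := by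
  have hfac : ∀ d ∈ (unitaryDivisors n).filter (fun d => unitaryMoebius (n / d) = s),
      (X : ℂ[X]) ^ d - 1 = ∏ j ∈ Icc 1 n, if n / d ∣ j then X - C (ζ ^ j) else 1 := fun d hd => by
    rw [X_pow_sub_one_eq_prod_filter_dvd hζ hn
      (mem_unitaryDivisors.1 (Finset.mem_filter.1 hd).1).1.1, Finset.prod_filter]
  rw [Finset.prod_congr rfl hfac, Finset.prod_comm]
  refine Finset.prod_congr rfl fun j _ => ?_
  rw [← Finset.prod_filter, Finset.prod_const, Finset.filter_filter]

/-- `Φ*_n(x) = ∏_{d ∣∣ n} (x^d - 1)^{μ*(n/d)}`, stated as the polynomial identity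
`Φ*_n(x) · ∏_{d ∣∣ n, μ*(n/d) = -1} (x^d - 1) = ∏_{d ∣∣ n, μ*(n/d) = 1} (x^d - 1)`. -/
theorem unitaryCyclotomic_moebius_inversion (n : ℕ) (hn : 0 < n) :
    unitaryCyclotomic n *
        ∏ d ∈ (unitaryDivisors n).filter fun d => unitaryMoebius (n / d) = -1,
          ((X : Polynomial ℂ) ^ d - 1) =
      ∏ d ∈ (unitaryDivisors n).filter fun d => unitaryMoebius (n / d) = 1,
        ((X : Polynomial ℂ) ^ d - 1) := by
  have hζ := Complex.isPrimitiveRoot_exp n hn.ne'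
  have hcyc : unitaryCyclotomic n = ∏ j ∈ Icc 1 n,
      (X - C (Complex.exp (2 * Real.pi * Complex.I / n) ^ j)) ^
        (if unitaryGcd j n = 1 then 1 else 0) := by
    rw [unitaryCyclotomic, Finset.prod_filter]
    refine Finset.prod_congr rfl fun j _ => ?_
    rw [pow_ite, pow_one, pow_zero, ← Complex.exp_nat_mul]
    congr 5
    ring
  rw [hcyc, prod_X_pow_sub_one_unitaryDivisors hζ hn, prod_X_pow_sub_one_unitaryDivisors hζ hn,
    ← Finset.prod_mul_distrib]
  refine Finset.prod_congr rfl fun j _ => ?_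
  rw [← pow_add, card_unitaryMoebius_eq_neg_one_add hn.ne']
end

section
/- For every odd integer n > 1, Φ*_{2n}(x) = Φ*_n(−x) as polynomials. -/
open Polynomial Finset

/-- `(j, n)_* = 1` means that `1` is the only unitary divisor of `n` dividing `j`. -/
theorem unitaryGcd_eq_one_iff_s5 {n : ℕ} (hn : n ≠ 0) (j : ℕ) :
    unitaryGcd j n = 1 ↔ ∀ d e, d * e = n → Nat.Coprime d e → d ∣ j → d = 1 := by
  have mem_iff : ∀ d, d ∈ (unitaryDivisors n).filter (fun d => d ∣ j) ↔
      (d ∣ n ∧ Nat.Coprime d (n / d)) ∧ d ∣ j := by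
    intro d
    simp [unitaryDivisors, hn]
  have mul_mem : ∀ d e, d * e = n → Nat.Coprime d e → d ∣ j →
      d ∈ (unitaryDivisors n).filter (fun d => d ∣ j) := by
    rintro d e rfl hc hj
    refine (mem_iff d).2 ⟨⟨dvd_mul_right d e, ?_⟩, hj⟩
    rwa [Nat.mul_div_cancel_left e (Nat.pos_of_ne_zero (left_ne_zero_of_mul hn))]
  constructor
  · intro h d e hde hc hj
    have hle : d ≤ unitaryGcd j n := Finset.le_sup (f := id) (mul_mem d e hde hc hj)
    have hd : d ≠ 0 := by
      rintro rfl
      simp at hde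
      exact hn hde.symm
    omega
  · intro h
    apply le_antisymm
    · refine Finset.sup_le fun d hd => ?_
      obtain ⟨⟨hdn, hc⟩, hj⟩ := (mem_iff d).1 hd
      exact (h d (n / d) (Nat.mul_div_cancel' hdn) hc hj).le
    · exact Finset.le_sup (f := id)
        (mul_mem 1 n (one_mul n) (Nat.coprime_one_left n) (one_dvd j))

theorem unitaryGcd_two_mul_eq_one_iff {n : ℕ} (hodd : Odd n) (j : ℕ) :
    unitaryGcd j (2 * n) = 1 ↔ Odd j ∧ unitaryGcd j n = 1 := by
  have hn : n ≠ 0 := hodd.pos.ne'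
  rw [unitaryGcd_eq_one_iff_s5 hn, unitaryGcd_eq_one_iff_s5 (mul_ne_zero two_ne_zero hn)]
  constructor
  · intro h
    refine ⟨?_, fun d e hde hc hj => ?_⟩
    · rw [← Nat.not_even_iff_odd, even_iff_two_dvd]
      intro hj
      have := h 2 n rfl (Nat.coprime_two_left.2 hodd) hj
      omega
    · have hd : Odd d := hodd.of_dvd_nat ⟨e, hde.symm⟩
      exact h d (2 * e) (by rw [← hde]; ring)
        (Nat.Coprime.mul_right (Nat.coprime_two_right.2 hd) hc) hj
  · rintro ⟨hj, h⟩ d e hde hc hdj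
    have hd : Odd d := hj.of_dvd_nat hdj
    obtain ⟨e, rfl⟩ : 2 ∣ e :=
      (Nat.coprime_two_left.2 hd).dvd_of_dvd_mul_left ⟨n, hde⟩
    exact h d e (by linarith [mul_left_comm d 2 e]) hc.coprime_mul_left_right hdj

/-- Whether `(j, n)_* = 1` depends only on which divisors of `n` divide `j`. -/
theorem unitaryGcd_eq_one_congr {n j k : ℕ} (h : ∀ d, d ∣ n → (d ∣ j ↔ d ∣ k)) :
    unitaryGcd j n = 1 ↔ unitaryGcd k n = 1 := by
  have hfilter : (unitaryDivisors n).filter (fun d => d ∣ j) =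
      (unitaryDivisors n).filter (fun d => d ∣ k) :=
    Finset.filter_congr fun d hd =>
      h d (Nat.dvd_of_mem_divisors (Finset.mem_filter.1 hd).1)
  rw [unitaryGcd, unitaryGcd, hfilter]

theorem unitaryGcd_eq_one_of_two_mul_modEq {n j k : ℕ} (hodd : Odd n)
    (h : 2 * k ≡ j [MOD n]) : unitaryGcd j n = 1 ↔ unitaryGcd k n = 1 :=
  unitaryGcd_eq_one_congr fun d hd => by
    rw [← h.dvd_iff hd]
    exact (Nat.coprime_two_right.2 (hodd.of_dvd_nat hd)).dvd_mul_left

theorem unitaryGcd_self_ne_one {n : ℕ} (hn : 1 < n) : unitaryGcd n n ≠ 1 := by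
  rw [Ne, unitaryGcd_eq_one_iff_s5 (by omega)]
  intro h
  have := h n 1 (mul_one n) (Nat.coprime_one_right n) dvd_rfl
  omega

/-- The unitary totient of an odd `n > 1` is even, via the involution `j ↦ n - j`. -/
theorem even_unitaryTotient {n : ℕ} (hn : 1 < n) (hodd : Odd n) : Even (unitaryTotient n) := by
  have hlt : ∀ j ∈ (Finset.Icc 1 n).filter (fun j => unitaryGcd j n = 1), 1 ≤ j ∧ j < n := by
    intro j hj
    simp only [Finset.mem_filter, Finset.mem_Icc] at hj
    refine ⟨hj.1.1, lt_of_le_of_ne hj.1.2 ?_⟩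
    rintro rfl
    exact unitaryGcd_self_ne_one hn hj.2
  have hprod : ∏ j ∈ (Finset.Icc 1 n).filter (fun j => unitaryGcd j n = 1), (-1 : ℤ) = 1 := by
    refine Finset.prod_involution (fun j _ => n - j) (fun _ _ => by norm_num) ?_ ?_ ?_
    · intro j hj _
      obtain ⟨m, rfl⟩ := hodd
      omega
    · intro j hj
      have hj' := hlt j hj
      simp only [Finset.mem_filter, Finset.mem_Icc] at hj ⊢
      refine ⟨by omega, (unitaryGcd_eq_one_congr fun d hd => ?_).2 hj.2⟩
      exact (Nat.dvd_sub_iff_right hj.1.2 hd)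
    · intro j hj
      have := hlt j hj
      omega
  rw [Finset.prod_const] at hprod
  exact (neg_one_pow_eq_one_iff_even (by norm_num)).1 hprod

theorem exp_two_mul_add_div_two_mul {n : ℕ} (hn : n ≠ 0) (k : ℕ) :
    Complex.exp (2 * (Real.pi : ℂ) * Complex.I * ((2 * k + n : ℕ) : ℂ) / ((2 * n : ℕ) : ℂ)) =
      -Complex.exp (2 * (Real.pi : ℂ) * Complex.I * (k : ℂ) / (n : ℂ)) := by
  have hn' : (n : ℂ) ≠ 0 := Nat.cast_ne_zero.2 hn
  rw [← Complex.exp_add_pi_mul_I]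
  congr 1
  push_cast
  field_simp

theorem exp_add_self_div {m : ℕ} (hm : m ≠ 0) (j : ℕ) :
    Complex.exp (2 * (Real.pi : ℂ) * Complex.I * ((j + m : ℕ) : ℂ) / (m : ℂ)) =
      Complex.exp (2 * (Real.pi : ℂ) * Complex.I * (j : ℂ) / (m : ℂ)) := by
  have hm' : (m : ℂ) ≠ 0 := Nat.cast_ne_zero.2 hm
  rw [← Complex.exp_periodic (2 * (Real.pi : ℂ) * Complex.I * (j : ℂ) / (m : ℂ))]
  congr 1
  push_cast
  field_simp

theorem unitaryCyclotomic_comp_neg_X {n : ℕ} (hn : 1 < n) (hodd : Odd n) :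
    (unitaryCyclotomic n).comp (-X) =
      ∏ j ∈ (Finset.Icc 1 n).filter fun j => unitaryGcd j n = 1,
        (X - C (-Complex.exp (2 * (Real.pi : ℂ) * Complex.I * (j : ℂ) / (n : ℂ)))) := by
  have hcomp : ∀ z : ℂ, (X - C z).comp (-X) = -1 * (X - C (-z)) := by
    intro z
    simp only [sub_comp, X_comp, C_comp, C_neg]
    ring
  rw [unitaryCyclotomic, Polynomial.prod_comp]
  simp only [hcomp]
  rw [Finset.prod_mul_distrib, Finset.prod_const]
  have heven := even_unitaryTotient hn hodd
  rw [unitaryTotient] at heven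
  rw [heven.neg_one_pow, one_mul]

/-- for odd `n > 1`, `Φ*_{2n}(x) = Φ*_n(-x)`. -/
theorem unitaryCyclotomic_two_mul (n : ℕ) (hn : 1 < n) (hodd : Odd n) :
    unitaryCyclotomic (2 * n) = (unitaryCyclotomic n).comp (-X) := by
  have hn0 : n ≠ 0 := by omega
  rw [unitaryCyclotomic_comp_neg_X hn hodd, unitaryCyclotomic]
  symm
  obtain ⟨m, hm⟩ := id hodd
  refine Finset.prod_nbij' (fun k => if 2 * k + n ≤ 2 * n then 2 * k + n else 2 * k + n - 2 * n)
    (fun j => if n < j then (j - n) / 2 else (j + n) / 2) ?_ ?_ ?_ ?_ ?_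
  · intro k hk
    simp only [Finset.mem_filter, Finset.mem_Icc, unitaryGcd_two_mul_eq_one_iff hodd] at hk ⊢
    refine ⟨by split_ifs <;> omega, ?_, (unitaryGcd_eq_one_of_two_mul_modEq hodd ?_).2 hk.2⟩
    · rw [Nat.odd_iff]
      split_ifs <;> omega
    · split_ifs with h
      · simp [Nat.ModEq]
      · have h2 : 2 * k = 2 * k + n - 2 * n + n := by omega
        conv_lhs => rw [h2]
        simp [Nat.ModEq]
  · intro j hj
    simp only [Finset.mem_filter, Finset.mem_Icc, unitaryGcd_two_mul_eq_one_iff hodd,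
      Nat.odd_iff] at hj ⊢
    refine ⟨by split_ifs <;> omega, (unitaryGcd_eq_one_of_two_mul_modEq hodd ?_).1 hj.2.2⟩
    split_ifs with h
    · have h2 : j = 2 * ((j - n) / 2) + n := by omega
      conv_rhs => rw [h2]
      simp [Nat.ModEq]
    · have h2 : 2 * ((j + n) / 2) = j + n := by omega
      rw [h2]
      simp [Nat.ModEq]
  · intro k hk
    simp only [Finset.mem_filter, Finset.mem_Icc] at hk
    split_ifs <;> omega
  · intro j hj
    simp only [Finset.mem_filter, Finset.mem_Icc, unitaryGcd_two_mul_eq_one_iff hodd,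
      Nat.odd_iff] at hj
    split_ifs <;> omega
  · intro k _
    rw [← exp_two_mul_add_div_two_mul hn0]
    split_ifs with h
    · rfl
    · rw [← exp_add_self_div (mul_ne_zero two_ne_zero hn0) (2 * k + n - 2 * n),
        Nat.sub_add_cancel (not_le.1 h).le]
end

section
/- Let f : ℕ → ℂ be an arbitrary arithmetic function. For all positive integers m and n: ∑_{k=1}^{n} f((k,n)_*) e^{2πi km/n} = ∑_{d ∣∣ n, (n/d) ∣ m} (n/d) · (μ* × f)(d), and also ∑_{k=1}^{n} f((k,n)_*) e^{2πi km/n} = ∑_{d ∣∣ n} f(d) c*_{n/d}(m). -/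
open Polynomial Finset

theorem mem_unitaryDivisors_iff {d n : ℕ} :
    d ∈ unitaryDivisors n ↔ ∃ c, n = d * c ∧ n ≠ 0 ∧ d.Coprime c := by
  rw [unitaryDivisors, mem_filter, Nat.mem_divisors]
  constructor
  · rintro ⟨⟨⟨c, rfl⟩, h0⟩, h⟩
    rw [Nat.mul_div_cancel_left _ (Nat.pos_of_ne_zero (left_ne_zero_of_mul h0))] at h
    exact ⟨c, rfl, h0, h⟩
  · rintro ⟨c, rfl, h0, h⟩
    rw [Nat.mul_div_cancel_left _ (Nat.pos_of_ne_zero (left_ne_zero_of_mul h0))]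
    exact ⟨⟨dvd_mul_right _ _, h0⟩, h⟩

theorem mem_unitaryDivisors_mul {d c : ℕ} :
    d ∈ unitaryDivisors (d * c) ↔ d * c ≠ 0 ∧ d.Coprime c := by
  rw [mem_unitaryDivisors_iff]
  constructor
  · rintro ⟨c', h, h0, hc⟩
    obtain rfl := Nat.eq_of_mul_eq_mul_left (Nat.pos_of_ne_zero (left_ne_zero_of_mul h0)) h
    exact ⟨h0, hc⟩
  · rintro ⟨h0, hc⟩
    exact ⟨c, rfl, h0, hc⟩

theorem dvd_of_mem_unitaryDivisors {d n : ℕ} (h : d ∈ unitaryDivisors n) : d ∣ n :=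
  Nat.dvd_of_mem_divisors (mem_filter.1 h).1

theorem pos_of_mem_unitaryDivisors {d n : ℕ} (h : d ∈ unitaryDivisors n) : 0 < d :=
  Nat.pos_of_mem_divisors (mem_filter.1 h).1

theorem one_mem_unitaryDivisors {n : ℕ} (hn : n ≠ 0) : 1 ∈ unitaryDivisors n :=
  mem_unitaryDivisors_iff.2 ⟨n, (one_mul n).symm, hn, Nat.coprime_one_left n⟩

theorem self_mem_unitaryDivisors {n : ℕ} (hn : n ≠ 0) : n ∈ unitaryDivisors n :=
  mem_unitaryDivisors_iff.2 ⟨1, (mul_one n).symm, hn, Nat.coprime_one_right n⟩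

/-- Unitary divisibility is transitive. -/
theorem unitaryDivisors_trans {d g n : ℕ} (hd : d ∈ unitaryDivisors g)
    (hg : g ∈ unitaryDivisors n) : d ∈ unitaryDivisors n := by
  obtain ⟨t, rfl, -, hdt⟩ := mem_unitaryDivisors_iff.1 hd
  obtain ⟨s, rfl, h0, hs⟩ := mem_unitaryDivisors_iff.1 hg
  rw [mul_assoc] at h0 ⊢
  exact mem_unitaryDivisors_mul.2 ⟨h0, hdt.mul_right hs.coprime_mul_right⟩

theorem mem_unitaryDivisors_of_dvd {d g n : ℕ} (hd : d ∈ unitaryDivisors n)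
    (hg : g ∈ unitaryDivisors n) (h : d ∣ g) : d ∈ unitaryDivisors g := by
  obtain ⟨t, rfl⟩ := h
  obtain ⟨s, rfl, h0, -⟩ := mem_unitaryDivisors_iff.1 hg
  rw [mul_assoc] at hd
  exact mem_unitaryDivisors_mul.2
    ⟨left_ne_zero_of_mul h0, (mem_unitaryDivisors_mul.1 hd).2.coprime_mul_right_right⟩

theorem lcm_mem_unitaryDivisors {d e n : ℕ} (hd : d ∈ unitaryDivisors n)
    (he : e ∈ unitaryDivisors n) : d.lcm e ∈ unitaryDivisors n := by
  obtain ⟨c, hc⟩ := Nat.lcm_dvd (dvd_of_mem_unitaryDivisors hd) (dvd_of_mem_unitaryDivisors he)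
  obtain ⟨a, ha⟩ := Nat.dvd_lcm_left d e
  obtain ⟨b, hb⟩ := Nat.dvd_lcm_right d e
  have hn : n ≠ 0 := by
    obtain ⟨_, -, h0, -⟩ := mem_unitaryDivisors_iff.1 hd
    exact h0
  refine mem_unitaryDivisors_iff.2 ⟨c, hc, hn, ?_⟩
  have h1 : d.Coprime c := by
    rw [hc, ha, mul_assoc] at hd
    exact (mem_unitaryDivisors_mul.1 hd).2.coprime_mul_left_right
  have h2 : e.Coprime c := by
    rw [hc, hb, mul_assoc] at he
    exact (mem_unitaryDivisors_mul.1 he).2.coprime_mul_left_right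
  exact (h1.mul_left h2).coprime_dvd_left (Nat.lcm_dvd_mul d e)

theorem unitaryGcd_mem {n : ℕ} (hn : n ≠ 0) (k : ℕ) :
    unitaryGcd k n ∈ unitaryDivisors n ∧ unitaryGcd k n ∣ k := by
  obtain ⟨g, hg, h⟩ := exists_mem_eq_sup ((unitaryDivisors n).filter fun d => d ∣ k)
    ⟨1, mem_filter.2 ⟨one_mem_unitaryDivisors hn, one_dvd k⟩⟩ id
  rw [unitaryGcd, h]
  exact mem_filter.1 hg

theorem dvd_unitaryGcd {d k n : ℕ} (hd : d ∈ unitaryDivisors n) (hk : d ∣ k) :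
    d ∣ unitaryGcd k n := by
  have hn : n ≠ 0 := by
    obtain ⟨_, -, h0, -⟩ := mem_unitaryDivisors_iff.1 hd
    exact h0
  obtain ⟨hg, hgk⟩ := unitaryGcd_mem hn k
  have hl := lcm_mem_unitaryDivisors hd hg
  have hle : d.lcm (unitaryGcd k n) ≤ unitaryGcd k n :=
    le_sup (f := id) (mem_filter.2 ⟨hl, Nat.lcm_dvd hk hgk⟩)
  have := Nat.le_antisymm hle
    (Nat.le_of_dvd (pos_of_mem_unitaryDivisors hl) (Nat.dvd_lcm_right d _))
  exact this ▸ Nat.dvd_lcm_left d _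

theorem unitaryDivisors_unitaryGcd {n : ℕ} (hn : n ≠ 0) (k : ℕ) :
    unitaryDivisors (unitaryGcd k n) = (unitaryDivisors n).filter fun d => d ∣ k := by
  obtain ⟨hg, hgk⟩ := unitaryGcd_mem hn k
  ext d
  rw [mem_filter]
  exact ⟨fun h => ⟨unitaryDivisors_trans h hg, (dvd_of_mem_unitaryDivisors h).trans hgk⟩,
    fun h => mem_unitaryDivisors_of_dvd h.1 hg (dvd_unitaryGcd h.1 h.2)⟩

theorem unitaryGcd_mul_eq_left_iff {d c : ℕ} (h : d ∈ unitaryDivisors (d * c)) (j : ℕ) :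
    unitaryGcd (d * j) (d * c) = d ↔ unitaryGcd j c = 1 := by
  obtain ⟨h0, hdc⟩ := mem_unitaryDivisors_mul.1 h
  have hd := pos_of_mem_unitaryDivisors h
  constructor
  · intro hg
    obtain ⟨ht, htj⟩ := unitaryGcd_mem (right_ne_zero_of_mul h0) j
    obtain ⟨s, hs, -, hts⟩ := mem_unitaryDivisors_iff.1 ht
    have hmem : d * unitaryGcd j c ∈ unitaryDivisors (d * c) := by
      refine mem_unitaryDivisors_iff.2 ⟨s, by rw [mul_assoc, ← hs], h0, ?_⟩
      exact (hdc.coprime_dvd_right ⟨_, hs.trans (mul_comm _ _)⟩).mul_left hts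
    have := dvd_unitaryGcd hmem (mul_dvd_mul_left d htj)
    rw [hg] at this
    exact Nat.dvd_one.1 (Nat.dvd_of_mul_dvd_mul_left hd (by simpa using this))
  · intro hg
    obtain ⟨hm, hmj⟩ := unitaryGcd_mem h0 (d * j)
    obtain ⟨t, ht⟩ := dvd_unitaryGcd h (dvd_mul_right d j)
    rw [ht] at hm hmj ⊢
    obtain ⟨s, hs, -, hts⟩ := mem_unitaryDivisors_iff.1 hm
    have hc : c = t * s := Nat.eq_of_mul_eq_mul_left hd (by rw [hs, mul_assoc])
    have htc : t ∈ unitaryDivisors c :=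
      mem_unitaryDivisors_iff.2 ⟨s, hc, right_ne_zero_of_mul h0, hts.coprime_mul_left⟩
    have := dvd_unitaryGcd htc (Nat.dvd_of_mul_dvd_mul_left hd hmj)
    rw [hg, Nat.dvd_one] at this
    rw [this, mul_one]

/-- Pairing `e` with `e * q` or `e / q`, where `q` is the full power of a prime in `n`, cancels
the sum of `μ*` over the unitary divisors of `n`. -/
theorem sum_unitaryMoebius_of_one_lt {n : ℕ} (hn : 1 < n) :
    ∑ e ∈ unitaryDivisors n, unitaryMoebius e = 0 := by
  obtain ⟨p, hp, hpn⟩ := Nat.exists_prime_and_dvd hn.ne'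
  obtain ⟨a, r, hr, rfl⟩ := Nat.exists_eq_pow_mul_and_not_dvd (by omega : n ≠ 0) p hp.ne_one
  have ha : a ≠ 0 := by
    rintro rfl
    simp [hr] at hpn
  have hr0 : r ≠ 0 := by
    rintro rfl
    simp at hr
  have hpr : p.Coprime r := (Nat.Prime.coprime_iff_not_dvd hp).2 hr
  have hqr : (p ^ a).Coprime r := hpr.pow_left a
  have hq : p ^ a ≠ 0 := pow_ne_zero a hp.ne_zero
  have hcop : ∀ e ∈ unitaryDivisors r, p.Coprime e := fun e he =>
    hpr.coprime_dvd_right (dvd_of_mem_unitaryDivisors he)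
  have hsplit : unitaryDivisors (p ^ a * r) =
      unitaryDivisors r ∪ (unitaryDivisors r).image (p ^ a * ·) := by
    ext e
    simp only [mem_union, mem_image]
    constructor
    · intro he
      obtain ⟨c, hc, h0, hec⟩ := mem_unitaryDivisors_iff.1 he
      by_cases hpe : p ∣ e
      · right
        have hqe : p ^ a ∣ e :=
          ((hec.coprime_dvd_left hpe).pow_left a).dvd_of_dvd_mul_right (hc ▸ dvd_mul_right _ _)
        obtain ⟨t, rfl⟩ := hqe
        refine ⟨t, mem_unitaryDivisors_iff.2 ⟨c, ?_, hr0, hec.coprime_mul_left⟩, rfl⟩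
        exact Nat.eq_of_mul_eq_mul_left (Nat.pos_of_ne_zero hq) (by rw [hc, mul_assoc])
      · left
        have hqe : p ^ a ∣ c :=
          (((Nat.Prime.coprime_iff_not_dvd hp).2 hpe).pow_left a).dvd_of_dvd_mul_left
            (hc ▸ dvd_mul_right _ _)
        obtain ⟨t, rfl⟩ := hqe
        refine mem_unitaryDivisors_iff.2 ⟨t, ?_, hr0, hec.coprime_mul_left_right⟩
        exact Nat.eq_of_mul_eq_mul_left (Nat.pos_of_ne_zero hq) (by rw [hc, mul_left_comm])
    · rintro (he | ⟨t, ht, rfl⟩)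
      · exact unitaryDivisors_trans he (mem_unitaryDivisors_iff.2
          ⟨p ^ a, mul_comm _ _, mul_ne_zero hq hr0, hqr.symm⟩)
      · obtain ⟨s, rfl, -, hts⟩ := mem_unitaryDivisors_iff.1 ht
        exact mem_unitaryDivisors_iff.2 ⟨s, (mul_assoc _ _ _).symm, mul_ne_zero hq hr0,
          hqr.coprime_mul_left_right.mul_left hts⟩
  have hdisj : Disjoint (unitaryDivisors r) ((unitaryDivisors r).image (p ^ a * ·)) := by
    rw [disjoint_left]
    rintro e he hi
    obtain ⟨t, -, rfl⟩ := mem_image.1 hi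
    exact (Nat.Prime.coprime_iff_not_dvd hp).1 (hcop _ he) ((dvd_pow_self p ha).mul_right t)
  rw [hsplit, sum_union hdisj,
    sum_image fun x _ y _ h => Nat.eq_of_mul_eq_mul_left (Nat.pos_of_ne_zero hq) h,
    ← sum_add_distrib]
  refine sum_eq_zero fun e he => ?_
  have hpe := (hcop e he).pow_left a
  rw [unitaryMoebius, unitaryMoebius, hpe.primeFactors_mul,
    card_union_of_disjoint hpe.disjoint_primeFactors, Nat.primeFactors_prime_pow ha hp,
    card_singleton, pow_add]
  ring

/-- Unitary Moebius inversion. -/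
theorem sum_unitaryConv_unitaryMoebius (f : ℕ → ℂ) {n : ℕ} (hn : n ≠ 0) :
    ∑ d ∈ unitaryDivisors n, unitaryConv (fun e => ((unitaryMoebius e : ℤ) : ℂ)) f d = f n := by
  have hswap : ∑ d ∈ unitaryDivisors n, unitaryConv (fun e => ((unitaryMoebius e : ℤ) : ℂ)) f d =
      ∑ c ∈ unitaryDivisors n, ∑ e ∈ unitaryDivisors (n / c),
        ((unitaryMoebius e : ℤ) : ℂ) * f c := by
    simp only [unitaryConv]
    rw [sum_sigma', sum_sigma']
    refine sum_bij' (fun x _ => ⟨x.1 / x.2, x.2⟩) (fun x _ => ⟨x.1 * x.2, x.2⟩) ?_ ?_ ?_ ?_ ?_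
    · rintro ⟨d, e⟩ h
      obtain ⟨hd, he⟩ := mem_sigma.1 h
      dsimp only at hd he
      have he0 := pos_of_mem_unitaryDivisors he
      obtain ⟨c, rfl, hec0, hec⟩ := mem_unitaryDivisors_iff.1 he
      obtain ⟨s, rfl, h0, hs⟩ := mem_unitaryDivisors_iff.1 hd
      have hc0 := Nat.pos_of_ne_zero (right_ne_zero_of_mul hec0)
      have hn' : e * c * s = c * (e * s) := by ring
      rw [mem_sigma]
      dsimp only
      rw [Nat.mul_div_cancel_left _ he0, hn', Nat.mul_div_cancel_left _ hc0,
        mem_unitaryDivisors_mul, mem_unitaryDivisors_mul]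
      rw [hn'] at h0
      exact ⟨⟨h0, hec.symm.mul_right hs.coprime_mul_left⟩, right_ne_zero_of_mul h0,
        hs.coprime_mul_right⟩
    · rintro ⟨c, e⟩ h
      obtain ⟨hc, he⟩ := mem_sigma.1 h
      dsimp only at hc he
      have hc0 := pos_of_mem_unitaryDivisors hc
      obtain ⟨r, rfl, h0, hcr⟩ := mem_unitaryDivisors_iff.1 hc
      rw [Nat.mul_div_cancel_left _ hc0] at he
      have he0 := pos_of_mem_unitaryDivisors he
      obtain ⟨s, rfl, -, hes⟩ := mem_unitaryDivisors_iff.1 he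
      rw [mem_sigma]
      dsimp only
      rw [← mul_assoc, mem_unitaryDivisors_mul, mul_comm c e, mem_unitaryDivisors_mul]
      exact ⟨⟨mul_ne_zero (mul_pos he0 hc0).ne' (right_ne_zero_of_mul (right_ne_zero_of_mul h0)), hes.mul_left hcr.coprime_mul_left_right⟩, by positivity,
        hcr.coprime_mul_right_right.symm⟩
    · rintro ⟨d, e⟩ h
      have he := dvd_of_mem_unitaryDivisors (mem_sigma.1 h).2
      simp [Nat.div_mul_cancel he]
    · rintro ⟨c, e⟩ h
      have he := pos_of_mem_unitaryDivisors (mem_sigma.1 h).2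
      simp [Nat.mul_div_cancel _ he]
    · rintro ⟨d, e⟩ h
      rfl
  rw [hswap, sum_eq_single_of_mem n (self_mem_unitaryDivisors hn)]
  · rw [Nat.div_self (Nat.pos_of_ne_zero hn)]
    simp [unitaryDivisors, unitaryMoebius, filter_singleton]
  · intro c hc hcn
    have hc0 := pos_of_mem_unitaryDivisors hc
    obtain ⟨r, rfl, h0, -⟩ := mem_unitaryDivisors_iff.1 hc
    rw [Nat.mul_div_cancel_left _ hc0, ← sum_mul, ← Int.cast_sum,
      sum_unitaryMoebius_of_one_lt, Int.cast_zero, zero_mul]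
    have : r ≠ 0 := right_ne_zero_of_mul h0
    have : r ≠ 1 := by
      rintro rfl
      simp at hcn
    omega

theorem sum_Icc_mul_filter_dvd {M : Type*} [AddCommMonoid M] (F : ℕ → M) {d : ℕ} (hd : 0 < d)
    (c : ℕ) : ∑ k ∈ (Icc 1 (d * c)).filter fun k => d ∣ k, F k = ∑ j ∈ Icc 1 c, F (d * j) := by
  rw [← sum_image (g := (d * ·)) fun x _ y _ h => Nat.eq_of_mul_eq_mul_left hd h]
  congr 1
  ext k
  simp only [mem_filter, mem_image, mem_Icc]
  constructor
  · rintro ⟨⟨h1, h2⟩, j, rfl⟩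
    exact ⟨j, ⟨Nat.pos_of_mul_pos_left h1, Nat.le_of_mul_le_mul_left h2 hd⟩, rfl⟩
  · rintro ⟨j, ⟨h1, h2⟩, rfl⟩
    exact ⟨⟨Nat.mul_pos hd h1, Nat.mul_le_mul_left d h2⟩, dvd_mul_right d j⟩

theorem sum_Icc_exp_two_pi {N : ℕ} (hN : N ≠ 0) (m : ℕ) :
    ∑ j ∈ Icc 1 N, Complex.exp (2 * (Real.pi : ℂ) * Complex.I * (j : ℂ) * (m : ℂ) / (N : ℂ)) =
      if N ∣ m then (N : ℂ) else 0 := by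
  have hζ := Complex.isPrimitiveRoot_exp N hN
  set ζ := Complex.exp (2 * Real.pi * Complex.I / N) with hζ_def
  have hterm : ∀ j : ℕ,
      Complex.exp (2 * (Real.pi : ℂ) * Complex.I * (j : ℂ) * (m : ℂ) / (N : ℂ)) =
        (ζ ^ m) ^ j := by
    intro j
    rw [← pow_mul, hζ_def, ← Complex.exp_nat_mul]
    congr 1
    push_cast
    ring
  simp only [hterm]
  split_ifs with h
  · rw [(hζ.pow_eq_one_iff_dvd m).2 h]
    simp
  · have h1 : ζ ^ m ≠ 1 := fun h' => h ((hζ.pow_eq_one_iff_dvd m).1 h')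
    have hN1 : (ζ ^ m) ^ N = 1 := by rw [← pow_mul, mul_comm, pow_mul, hζ.pow_eq_one, one_pow]
    rw [← Ico_add_one_right_eq_Icc, geom_sum_Ico h1 (by omega), pow_succ, hN1]
    simp

theorem exp_two_pi_mul_cancel {d : ℕ} (hd : 0 < d) (j m c : ℕ) :
    Complex.exp (2 * (Real.pi : ℂ) * Complex.I * ((d * j : ℕ) : ℂ) * (m : ℂ) /
      ((d * c : ℕ) : ℂ)) =
      Complex.exp (2 * (Real.pi : ℂ) * Complex.I * (j : ℂ) * (m : ℂ) / (c : ℂ)) := by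
  have hd' : (d : ℂ) ≠ 0 := Nat.cast_ne_zero.2 hd.ne'
  congr 1
  push_cast
  rw [← mul_div_mul_left _ (c : ℂ) hd']
  congr 1
  ring

/-- the DFT identities
`∑_{k=1}^n f((k,n)_*) e^{2πikm/n} = ∑_{d ∣∣ n, (n/d) ∣ m} (n/d)·(μ* × f)(d)`
and `∑_{k=1}^n f((k,n)_*) e^{2πikm/n} = ∑_{d ∣∣ n} f(d) c*_{n/d}(m)`. -/
theorem unitary_dft_identities (f : ℕ → ℂ) (m n : ℕ) (hm : 0 < m) (hn : 0 < n) :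
    (∑ k ∈ Finset.Icc 1 n, f (unitaryGcd k n) *
        Complex.exp (2 * (Real.pi : ℂ) * Complex.I * (k : ℂ) * (m : ℂ) / (n : ℂ)) =
      ∑ d ∈ (unitaryDivisors n).filter fun d => (n / d) ∣ m,
        ((n / d : ℕ) : ℂ) *
          unitaryConv (fun e => ((unitaryMoebius e : ℤ) : ℂ)) f d) ∧
    (∑ k ∈ Finset.Icc 1 n, f (unitaryGcd k n) *
        Complex.exp (2 * (Real.pi : ℂ) * Complex.I * (k : ℂ) * (m : ℂ) / (n : ℂ)) =
      ∑ d ∈ unitaryDivisors n, f d * unitaryRamanujan (n / d) m) := by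
  constructor
  · have hf : ∀ k, f (unitaryGcd k n) = ∑ d ∈ (unitaryDivisors n).filter fun d => d ∣ k,
        unitaryConv (fun e => ((unitaryMoebius e : ℤ) : ℂ)) f d := by
      intro k
      rw [← unitaryDivisors_unitaryGcd hn.ne',
        sum_unitaryConv_unitaryMoebius f (pos_of_mem_unitaryDivisors
          (unitaryGcd_mem hn.ne' k).1).ne']
    simp only [hf, sum_filter, sum_mul]
    rw [sum_comm]
    refine sum_congr rfl fun d hd => ?_
    have hd0 := pos_of_mem_unitaryDivisors hd
    obtain ⟨c, rfl, h0, -⟩ := mem_unitaryDivisors_iff.1 hd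
    simp only [ite_mul, zero_mul]
    rw [← sum_filter, sum_Icc_mul_filter_dvd _ hd0, Nat.mul_div_cancel_left _ hd0]
    simp only [exp_two_pi_mul_cancel hd0]
    rw [← mul_sum, sum_Icc_exp_two_pi (right_ne_zero_of_mul h0), mul_ite, mul_zero, mul_comm]
  · rw [← sum_fiberwise_of_maps_to fun k _ => (unitaryGcd_mem hn.ne' k).1]
    refine sum_congr rfl fun d hd => ?_
    have hd0 := pos_of_mem_unitaryDivisors hd
    obtain ⟨c, rfl, h0, -⟩ := mem_unitaryDivisors_iff.1 hd
    have hfilter : ((Icc 1 (d * c)).filter fun k => unitaryGcd k (d * c) = d) =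
        ((Icc 1 (d * c)).filter fun k => d ∣ k).filter fun k => unitaryGcd k (d * c) = d := by
      rw [filter_filter]
      refine filter_congr fun k _ => ⟨fun h => ⟨?_, h⟩, And.right⟩
      have := (unitaryGcd_mem h0 k).2
      rwa [h] at this
    rw [hfilter, sum_filter, sum_Icc_mul_filter_dvd _ hd0, Nat.mul_div_cancel_left _ hd0,
      unitaryRamanujan, mul_sum, sum_filter]
    refine sum_congr rfl fun j _ => ?_
    rw [exp_two_pi_mul_cancel hd0]
    by_cases hj : unitaryGcd j c = 1
    · have hj' := (unitaryGcd_mul_eq_left_iff hd j).2 hj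
      rw [if_pos hj, if_pos hj', hj']
    · rw [if_neg hj, if_neg fun h => hj ((unitaryGcd_mul_eq_left_iff hd j).1 h)]
end
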